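/- The real part of G(χ,ψ)³ equals cq/2 and the absolute value of the imaginary part of G(χ,ψ)³ equals (3√3/2)·q·d; in other words, G(χ,ψ)³ = cq/2 + θ(q)·(3√3·q·d/2)·i. -/

import Mathlib

/-- A prime `p ≡ 2 (mod 3)` is inert in the Eisenstein integers. -/
lemma dvd_and_dvd_of_dvd_sq_sub_mul_add_sq {p : ℕ} [Fact p.Prime] (hp : p % 3 = 2) {a b : ℤ}
    (h : (p : ℤ) ∣ a ^ 2 - a * b + b ^ 2) : (p : ℤ) ∣ a ∧ (p : ℤ) ∣ b := by
  have h3 : (3 : ZMod p) ≠ 0 := by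
    intro h0
    have h1 : p ∣ 3 := (ZMod.natCast_eq_zero_iff 3 p).1 (mod_cast h0)
    rcases (Nat.dvd_prime Nat.prime_three).1 h1 with h2 | h2 <;> omega
  have hinj : ∀ x y : ZMod p, y ≠ 0 → x ^ 3 = y ^ 3 → x = y := by
    intro x y hy hxy
    have hu : (x / y) ^ 3 = 1 := by rw [div_pow, hxy, div_self (pow_ne_zero 3 hy)]
    have hu0 : x / y ≠ 0 := by
      intro h0
      simp [h0] at hu
    have hu' : (x / y) ^ (p - 1) = 1 := ZMod.pow_card_sub_one_eq_one hu0
    have hd : orderOf (x / y) ∣ Nat.gcd 3 (p - 1) :=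
      Nat.dvd_gcd (orderOf_dvd_of_pow_eq_one hu) (orderOf_dvd_of_pow_eq_one hu')
    have hg : Nat.gcd 3 (p - 1) = 1 := by
      refine (Nat.Prime.coprime_iff_not_dvd Nat.prime_three).2 ?_
      omega
    rw [hg, Nat.dvd_one, orderOf_eq_one_iff] at hd
    exact (div_eq_one_iff_eq hy).1 hd
  rw [← ZMod.intCast_zmod_eq_zero_iff_dvd] at h
  simp only [← ZMod.intCast_zmod_eq_zero_iff_dvd]
  push_cast at h
  have hb : (b : ZMod p) = 0 := by
    by_contra hb
    have h1 := hinj a (-b) (neg_ne_zero.2 hb) (by linear_combination ((a : ZMod p) + b) * h)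
    rw [h1] at h
    have h2 : (3 : ZMod p) * (b : ZMod p) ^ 2 = 0 := by linear_combination h
    simp [h3, hb] at h2
  rw [hb] at h
  exact ⟨by simpa using h, hb⟩

lemma eq_zero_of_sq_sub_mul_add_sq_eq_pow {p : ℕ} [Fact p.Prime] (hp : p % 3 = 2) (m : ℕ)
    {a b : ℤ} (h : a ^ 2 - a * b + b ^ 2 = (p : ℤ) ^ (2 * m)) (hb : (3 : ℤ) ∣ b) : b = 0 := by
  have hp0 : (p : ℤ) ≠ 0 := by exact_mod_cast (Fact.out : p.Prime).ne_zero
  induction m generalizing a b with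
  | zero =>
    obtain ⟨e, rfl⟩ := hb
    simp only [mul_zero, pow_zero] at h
    by_contra he
    have he0 : e ≠ 0 := by
      rintro rfl
      simp at he
    have : 1 ≤ e ^ 2 := sq_pos_of_ne_zero he0
    nlinarith [sq_nonneg (2 * a - 3 * e)]
  | succ m ih =>
    obtain ⟨⟨a, rfl⟩, ⟨b, rfl⟩⟩ := dvd_and_dvd_of_dvd_sq_sub_mul_add_sq hp
      (h ▸ dvd_pow_self (p : ℤ) (by omega))
    have hcop : IsCoprime (3 : ℤ) p := by
      rw [show (3 : ℤ) = (3 : ℕ) from rfl, Nat.isCoprime_iff_coprime,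
        Nat.Prime.coprime_iff_not_dvd Nat.prime_three]
      omega
    have h' : a ^ 2 - a * b + b ^ 2 = (p : ℤ) ^ (2 * m) := by
      refine mul_left_cancel₀ (pow_ne_zero 2 hp0) ?_
      rw [← pow_add]
      linear_combination h
    rw [ih h' (hcop.dvd_of_dvd_mul_left hb), mul_zero]

lemma eq_zero_of_four_mul_pow_eq {p k : ℕ} [Fact p.Prime] (hp : p % 3 = 2)
    (hk : p ^ k % 3 = 1) {c d : ℤ} (h : 4 * (p : ℤ) ^ k = c ^ 2 + 27 * d ^ 2) : d = 0 := by
  obtain ⟨m, rfl⟩ : ∃ m, k = 2 * m := by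
    rcases Nat.even_or_odd' k with ⟨m, rfl | rfl⟩
    · exact ⟨m, rfl⟩
    · rw [Nat.pow_mod, hp, pow_succ, pow_mul, Nat.mul_mod, Nat.pow_mod] at hk
      simp at hk
  have hpar : (2 : ℤ) ∣ c + 3 * d := by
    have h2 : Even (c ^ 2 + 27 * d ^ 2) := ⟨2 * (p : ℤ) ^ (2 * m), by rw [← h]; ring⟩
    rw [← even_iff_two_dvd]
    have h27 : ¬ Even (27 : ℤ) := by decide
    have h3 : ¬ Even (3 : ℤ) := by decide
    simpa [Int.even_add, Int.even_mul, Int.even_pow, h27, h3] using h2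
  obtain ⟨a, ha⟩ := hpar
  have := eq_zero_of_sq_sub_mul_add_sq_eq_pow hp m (a := a) (b := 3 * d)
    (by
      obtain rfl : c = 2 * a - 3 * d := by linarith
      linarith) (dvd_mul_right 3 d)
  omega

lemma sq_eq_sq_of_four_mul_pow_eq {p k : ℕ} [Fact p.Prime] (hp : p % 3 = 1)
    {c d c' d' : ℤ} (h : 4 * (p : ℤ) ^ k = c ^ 2 + 27 * d ^ 2)
    (h' : 4 * (p : ℤ) ^ k = c' ^ 2 + 27 * d' ^ 2)
    (hc : ¬ (p : ℤ) ∣ c) (hc' : ¬ (p : ℤ) ∣ c') (hk : 0 < k) : d ^ 2 = d' ^ 2 := by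
  have hpr : Prime (p : ℤ) := Nat.prime_iff_prime_int.1 Fact.out
  have hp2 : ¬ (p : ℤ) ∣ 2 := by
    intro h2
    rcases (Nat.dvd_prime Nat.prime_two).1 (by exact_mod_cast h2 : p ∣ 2) with rfl | rfl
    · exact (Fact.out : Nat.Prime 1).ne_one rfl
    · omega
  have hq : (0 : ℤ) < (p : ℤ) ^ k := pow_pos (by exact_mod_cast (Fact.out : p.Prime).pos) k
  have key : ∀ e : ℤ, e ^ 2 = 1 → (p : ℤ) ^ k ∣ c * d' - e * (c' * d) → d ^ 2 = d' ^ 2 := by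
    rintro e he ⟨m, hm⟩
    have h1 : (c * c' + 27 * e * d * d') ^ 2 + 27 * (c * d' - e * (c' * d)) ^ 2
        = 16 * ((p : ℤ) ^ k) ^ 2 := by
      linear_combination (-4 * (p : ℤ) ^ k) * h - (c ^ 2 + 27 * d ^ 2) * h' +
        27 * d ^ 2 * (27 * d' ^ 2 + c' ^ 2) * he
    have hm0 : m = 0 := by
      by_contra hm0
      have h2 : 1 ≤ m ^ 2 := sq_pos_of_ne_zero hm0
      rw [hm] at h1
      nlinarith [sq_nonneg (c * c' + 27 * e * d * d'), pow_pos hq 2]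
    rw [hm0, mul_zero] at hm
    have h3 : 4 * (p : ℤ) ^ k * (d' ^ 2 - d ^ 2) = 0 := by
      linear_combination d' ^ 2 * h - d ^ 2 * h' + (c * d' + e * (c' * d)) * hm +
        c' ^ 2 * d ^ 2 * he
    rcases mul_eq_zero.1 h3 with h4 | h4
    · omega
    · linarith
  have hprod : (p : ℤ) ^ k ∣ (c * d' - c' * d) * (c * d' + c' * d) :=
    ⟨4 * (d' ^ 2 - d ^ 2), by linear_combination d ^ 2 * h' - d' ^ 2 * h⟩
  by_cases hX : (p : ℤ) ∣ c * d' - c' * d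
  · have hY : ¬ (p : ℤ) ∣ c * d' + c' * d := by
      intro hY
      have h2 : (p : ℤ) ∣ 2 * (c * d') := by
        rw [show 2 * (c * d') = (c * d' - c' * d) + (c * d' + c' * d) by ring]
        exact dvd_add hX hY
      have hd' : (p : ℤ) ∣ d' :=
        (hpr.dvd_or_dvd ((hpr.dvd_or_dvd h2).resolve_left hp2)).resolve_left hc
      refine hc' (hpr.dvd_of_dvd_pow (n := 2) ?_)
      have h5 : c' ^ 2 = 4 * (p : ℤ) ^ k - 27 * d' ^ 2 := by linarith
      rw [h5]
      exact dvd_sub (dvd_mul_of_dvd_right (dvd_pow_self _ hk.ne') _)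
        (dvd_mul_of_dvd_right (dvd_pow hd' two_ne_zero) _)
    refine key 1 (by norm_num) ?_
    rw [one_mul]
    exact (((Prime.coprime_iff_not_dvd hpr).2 hY).pow_left).dvd_of_dvd_mul_right hprod
  · refine key (-1) (by norm_num) ?_
    rw [neg_one_mul, sub_neg_eq_add]
    exact (((Prime.coprime_iff_not_dvd hpr).2 hX).pow_left).dvd_of_dvd_mul_left hprod

/-- `(2n choose n)` is prime to `p` when `3n = p ^ k - 1` and `p ≡ 1 (mod 3)`, by Lucas. -/
lemma not_dvd_choose_of_three_mul_add_one_eq_pow {p : ℕ} [Fact p.Prime] (hp : p % 3 = 1)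
    (k : ℕ) {n : ℕ} (hn : 3 * n + 1 = p ^ k) : ¬ p ∣ (2 * n).choose n := by
  have hpp : p.Prime := Fact.out
  induction k generalizing n with
  | zero =>
    obtain rfl : n = 0 := by simpa using hn
    simpa using hpp.one_lt.ne'
  | succ k ih =>
    obtain ⟨r, hr⟩ : ∃ r, p = 3 * r + 1 := ⟨p / 3, by omega⟩
    obtain ⟨m, hm⟩ : ∃ m, p ^ k = 3 * m + 1 := by
      have : p ^ k % 3 = 1 := by simp [Nat.pow_mod, hp]
      exact ⟨p ^ k / 3, by omega⟩
    have hn' : n = r + p * m := by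
      have h1 : 3 * n + 1 = (3 * m + 1) * p := by rw [hn, pow_succ, hm]
      have h2 : (3 * m + 1) * p = 3 * (p * m) + p := by ring
      omega
    have hr1 : r < p := by omega
    have hr2 : 2 * r < p := by have := hpp.two_le; omega
    have h2n : 2 * n = 2 * r + p * (2 * m) := by rw [hn']; ring
    have e1 : n % p = r := by rw [hn', Nat.add_mul_mod_self_left, Nat.mod_eq_of_lt hr1]
    have e2 : n / p = m := by
      rw [hn', Nat.add_mul_div_left _ _ hpp.pos, Nat.div_eq_of_lt hr1, zero_add]
    have e3 : 2 * n % p = 2 * r := by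
      rw [h2n, Nat.add_mul_mod_self_left, Nat.mod_eq_of_lt hr2]
    have e4 : 2 * n / p = 2 * m := by
      rw [h2n, Nat.add_mul_div_left _ _ hpp.pos, Nat.div_eq_of_lt hr2, zero_add]
    have hL := Choose.choose_modEq_choose_mod_mul_choose_div_nat (n := 2 * n) (k := n) (p := p)
    rw [e1, e2, e3, e4] at hL
    rw [hL.dvd_iff dvd_rfl, hpp.dvd_mul, not_or]
    refine ⟨fun h => ?_, ih hm.symm⟩
    have h1 : p ∣ (2 * r).factorial := by
      rw [← Nat.choose_mul_factorial_mul_factorial (show r ≤ 2 * r by omega), mul_assoc]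
      exact h.mul_right _
    exact hr2.not_ge (hpp.dvd_factorial.1 h1)

open Finset in
lemma sum_pow_eq_ite {F : Type*} [Field F] [Fintype F] {i : ℕ} (hi : 0 < i) :
    ∑ x : F, x ^ i = if Fintype.card F - 1 ∣ i then -1 else 0 := by
  classical
  rw [← FiniteField.sum_pow_units, ← sum_sdiff (subset_univ {(0 : F)}), sum_singleton,
    zero_pow hi.ne', add_zero]
  symm
  refine sum_bij (fun x _ => (x : F)) (by simp) (fun x _ y _ h => Units.ext h) ?_ (by simp)
  intro x hx
  exact ⟨Units.mk0 x (by simpa using hx), mem_univ _, rfl⟩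

open Finset in
lemma sum_mul_one_sub_pow {F : Type*} [Field F] [Fintype F] (i : ℕ) (hi : 0 < i) :
    ∑ x : F, (x * (1 - x)) ^ i = ∑ m ∈ range (i + 1),
      (-1) ^ m * (i.choose m : F) * (if Fintype.card F - 1 ∣ i + m then -1 else 0) := by
  have h : ∀ x : F, (x * (1 - x)) ^ i =
      ∑ m ∈ range (i + 1), (-1) ^ m * (i.choose m : F) * x ^ (i + m) := by
    intro x
    rw [mul_pow, show (1 : F) - x = -x + 1 by ring, add_pow, mul_sum]
    refine sum_congr rfl fun m _ => ?_
    rw [neg_pow, pow_add]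
    ring
  simp_rw [h]
  rw [sum_comm]
  refine sum_congr rfl fun m _ => ?_
  rw [← mul_sum, sum_pow_eq_ite (by omega)]

open Finset in
lemma sum_mul_one_sub_pow_third {F : Type*} [Field F] [Fintype F] {n : ℕ} (hn : 0 < n)
    (hF : Fintype.card F = 3 * n + 1) : ∑ x : F, (x * (1 - x)) ^ n = 0 := by
  rw [sum_mul_one_sub_pow n hn, hF]
  refine sum_eq_zero fun m hm => ?_
  rw [mem_range] at hm
  rw [if_neg, mul_zero]
  intro h
  have := Nat.le_of_dvd (by omega) h
  omega

open Finset in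
lemma sum_mul_one_sub_pow_two_thirds {F : Type*} [Field F] [Fintype F] {n : ℕ} (hn : 0 < n)
    (hF : Fintype.card F = 3 * n + 1) :
    ∑ x : F, (x * (1 - x)) ^ (2 * n) = (-1) ^ (n + 1) * ((2 * n).choose n : F) := by
  rw [sum_mul_one_sub_pow (2 * n) (by omega), hF, sum_eq_single n]
  · rw [if_pos ⟨1, by omega⟩]
    ring
  · intro m hm hmn
    rw [mem_range] at hm
    rw [if_neg, mul_zero]
    rintro ⟨t, ht⟩
    rw [Nat.add_sub_cancel] at ht
    have ht1 : t < 2 := by nlinarith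
    interval_cases t <;> omega
  · intro h
    exact absurd (mem_range.2 (by omega)) h

lemma pow_add_pow_two_mul_of_one_add_add_sq {R : Type*} [CommRing R] {w : R}
    (hw : 1 + w + w ^ 2 = 0) (n : ℕ) :
    w ^ n + w ^ (2 * n) = ((if 3 ∣ n then 2 else -1 : ℤ) : R) := by
  have hw3 : w ^ 3 = 1 := by linear_combination (w - 1) * hw
  have hm : w ^ n = w ^ (n % 3) := by
    conv_lhs => rw [← Nat.div_add_mod n 3, pow_add, pow_mul, hw3, one_pow, one_mul]
  simp only [mul_comm 2 n, pow_mul, hm, Nat.dvd_iff_mod_eq_zero]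
  have h3 : n % 3 < 3 := Nat.mod_lt _ (by norm_num)
  interval_cases n % 3
  · norm_num
  · push_cast
    linear_combination hw
  · push_cast
    linear_combination hw + w * hw3

lemma one_add_add_sq_of_pow_three_eq_one {K : Type*} [Field K] {w : K} (hw : w ^ 3 = 1)
    (hw1 : w ≠ 1) : 1 + w + w ^ 2 = 0 := by
  refine (mul_eq_zero.1 (?_ : (w - 1) * (1 + w + w ^ 2) = 0)).resolve_left (sub_ne_zero.2 hw1)
  linear_combination hw

/-- `χ + χ²` takes integer values, congruent modulo the characteristic to those of a
power sum. -/
lemma exists_int_eq_apply_add_apply_sq {F R : Type*} [Field F] [Fintype F] [Field R]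
    {χ : MulChar F R} (hχ : χ ^ 3 = 1) (hχ1 : χ ≠ 1) {n : ℕ} (hn : 0 < n)
    (hF : Fintype.card F = 3 * n + 1) (u : F) :
    ∃ t : ℤ, χ u + χ u ^ 2 = t ∧ u ^ n + u ^ (2 * n) = t := by
  rcases eq_or_ne u 0 with rfl | hu
  · exact ⟨0, by simp [MulChar.map_zero], by simp [hn.ne']⟩
  obtain ⟨g, hg⟩ := IsCyclic.exists_generator (α := Fˣ)
  have hord : orderOf g = 3 * n := by
    rw [orderOf_eq_card_of_forall_mem_zpowers hg, Nat.card_units, Nat.card_eq_fintype_card, hF,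
      Nat.add_sub_cancel]
  obtain ⟨m, hm⟩ := (Submonoid.mem_powers_iff _ _).1
    ((mem_powers_iff_mem_zpowers).2 (hg (Units.mk0 u hu)))
  have hum : u = (g : F) ^ m := by
    rw [← Units.val_pow_eq_pow_val, hm, Units.val_mk0]
  have hw : 1 + χ g + χ g ^ 2 = 0 := by
    refine one_add_add_sq_of_pow_three_eq_one ?_ ?_
    · rw [← MulChar.pow_apply_coe, hχ, MulChar.one_apply_coe]
    · intro h1
      refine hχ1 ((MulChar.eq_one_iff).2 fun x => ?_)
      obtain ⟨j, rfl⟩ := (Submonoid.mem_powers_iff _ _).1 ((mem_powers_iff_mem_zpowers).2 (hg x))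
      rw [Units.val_pow_eq_pow_val, map_pow, h1, one_pow]
  have hz : 1 + (g : F) ^ n + ((g : F) ^ n) ^ 2 = 0 := by
    refine one_add_add_sq_of_pow_three_eq_one ?_ ?_
    · rw [← pow_mul, mul_comm, ← hord, ← Units.val_pow_eq_pow_val, pow_orderOf_eq_one,
        Units.val_one]
    · rw [← Units.val_pow_eq_pow_val, Units.val_eq_one.ne]
      exact pow_ne_one_of_lt_orderOf hn.ne' (by omega)
  refine ⟨if 3 ∣ m then 2 else -1, ?_, ?_⟩
  · rw [← pow_add_pow_two_mul_of_one_add_add_sq hw, hum, map_pow]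
    ring
  · rw [← pow_add_pow_two_mul_of_one_add_add_sq hz, hum]
    ring

lemma ofReal_sqrt_three_sq : (Real.sqrt 3 : ℂ) ^ 2 = 3 := by
  rw [← Complex.ofReal_pow, Real.sq_sqrt (by norm_num)]
  norm_num

lemma one_add_add_sq_neg_one_add_sqrt_three_mul_I_div_two :
    1 + (-1 + (Real.sqrt 3 : ℂ) * Complex.I) / 2 +
      ((-1 + (Real.sqrt 3 : ℂ) * Complex.I) / 2) ^ 2 = 0 := by
  linear_combination (1 / 4 : ℂ) * (Real.sqrt 3 : ℂ) ^ 2 * Complex.I_sq -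
    (1 / 4 : ℂ) * ofReal_sqrt_three_sq

/-- The shape of the Jacobi sum `J(χ,χ)` of a cubic character. -/
theorem exists_two_mul_jacobiSum_eq {p k : ℕ} [Fact p.Prime] {F : Type*} [Field F] [Fintype F]
    [CharP F p] (hF : Fintype.card F = p ^ k) (hp : p ^ k % 3 = 1) (hk : 0 < k)
    {χ : MulChar F ℂ} (hχ : χ ^ 3 = 1) (hχ1 : χ ≠ 1) :
    ∃ c d : ℤ, c % 3 = 1 ∧ 4 * (p : ℤ) ^ k = c ^ 2 + 27 * d ^ 2 ∧
      (p % 3 = 1 → ¬ (p : ℤ) ∣ c) ∧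
      2 * jacobiSum χ χ = c + 3 * d * (Real.sqrt 3 : ℂ) * Complex.I := by
  have hs := ofReal_sqrt_three_sq
  have hpk : 1 < p ^ k := Nat.one_lt_pow hk.ne' (Fact.out : p.Prime).one_lt
  obtain ⟨n, hn⟩ : ∃ n, p ^ k = 3 * n + 1 := ⟨p ^ k / 3, by omega⟩
  have hn0 : 0 < n := by omega
  set μ : ℂ := (-1 + (Real.sqrt 3 : ℂ) * Complex.I) / 2 with hμ
  have hμ2 : 1 + μ + μ ^ 2 = 0 := one_add_add_sq_neg_one_add_sqrt_three_mul_I_div_two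
  have hμp : IsPrimitiveRoot μ 3 := by
    have hμ3 : μ ^ 3 = 1 := by linear_combination (μ - 1) * hμ2
    have hμ1 : μ ≠ 1 := by
      intro h
      norm_num [h] at hμ2
    have h3 : Fact (Nat.Prime 3) := ⟨Nat.prime_three⟩
    rw [← orderOf_eq_prime hμ3 hμ1]
    exact IsPrimitiveRoot.orderOf μ
  obtain ⟨z, hz, hJ⟩ := exists_jacobiSum_eq_neg_one_add (n := 3) (by norm_num) hχ hχ
    (by rw [hF, hn]; simp) hμp
  have hmem : ∃ a b : ℤ, z = a + b * μ := by
    refine Algebra.adjoin_induction (p := fun z _ => ∃ a b : ℤ, z = a + b * μ)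
      ?_ ?_ ?_ ?_ hz
    · rintro x rfl
      exact ⟨0, 1, by simp⟩
    · intro r
      exact ⟨r, 0, by simp⟩
    · rintro _ _ _ _ ⟨a, b, rfl⟩ ⟨a', b', rfl⟩
      exact ⟨a + a', b + b', by push_cast; ring⟩
    · rintro _ _ _ _ ⟨a, b, rfl⟩ ⟨a', b', rfl⟩
      exact ⟨a * a' - b * b', a * b' + b * a' - b * b', by
        push_cast
        linear_combination (b * b' : ℂ) * hμ2⟩
  obtain ⟨a, b, rfl⟩ := hmem
  have hJ2 : 2 * jacobiSum χ χ = ((3 * a + 3 * b - 2 : ℤ) : ℂ)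
      + 3 * ((b - a : ℤ) : ℂ) * (Real.sqrt 3 : ℂ) * Complex.I := by
    have hJ' : jacobiSum χ χ = (3 * b - 1) + 3 * (b - a) * μ := by
      rw [hJ]
      linear_combination (a + b * μ - 3 * b : ℂ) * hμ2
    rw [hJ', hμ]
    push_cast
    ring
  have hinv : χ⁻¹ = χ ^ 2 := inv_eq_of_mul_eq_one_right (by rw [← pow_succ', hχ])
  have hχ2 : χ * χ ≠ 1 := by
    rw [← sq, ← hinv]
    exact inv_ne_one.2 hχ1
  have hstar : star (jacobiSum χ χ) = jacobiSum χ⁻¹ χ⁻¹ := by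
    simp only [jacobiSum, star_sum, star_mul', MulChar.star_apply']
  have hJ2' : 2 * jacobiSum χ⁻¹ χ⁻¹ = ((3 * a + 3 * b - 2 : ℤ) : ℂ)
      - 3 * ((b - a : ℤ) : ℂ) * (Real.sqrt 3 : ℂ) * Complex.I := by
    have h := congrArg star hJ2
    rw [star_mul', hstar] at h
    simp only [Complex.star_def, map_add, map_mul, map_intCast, Complex.conj_ofReal,
      Complex.conj_I, map_ofNat] at h
    rw [h]
    ring
  have hnorm : jacobiSum χ χ * jacobiSum χ⁻¹ χ⁻¹ = (p : ℂ) ^ k := by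
    have hchar : ringChar ℂ ≠ ringChar F := by
      rw [ringChar.eq_zero, ringChar.eq F p]
      exact (Fact.out : p.Prime).ne_zero.symm
    rw [jacobiSum_mul_jacobiSum_inv hchar hχ1 hχ1 hχ2, hF, Nat.cast_pow]
  refine ⟨3 * a + 3 * b - 2, b - a, by omega, ?_, ?_, hJ2⟩
  · have h : (4 * (p : ℂ) ^ k) =
        ((3 * a + 3 * b - 2 : ℤ) : ℂ) ^ 2 + 27 * ((b - a : ℤ) : ℂ) ^ 2 := by
      rw [← hnorm]
      linear_combination (2 * jacobiSum χ⁻¹ χ⁻¹) * hJ2 + (((3 * a + 3 * b - 2 : ℤ) : ℂ)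
        + 3 * ((b - a : ℤ) : ℂ) * (Real.sqrt 3 : ℂ) * Complex.I) * hJ2'
        - 9 * ((b - a : ℤ) : ℂ) ^ 2 * (Real.sqrt 3 : ℂ) ^ 2 * Complex.I_sq
        + 9 * ((b - a : ℤ) : ℂ) ^ 2 * hs
    exact_mod_cast h
  · intro hp1 hdvd
    choose t ht ht' using exists_int_eq_apply_add_apply_sq hχ hχ1 hn0 (hF.trans hn)
    have hsum : 3 * a + 3 * b - 2 = ∑ x : F, t (x * (1 - x)) := by
      have h : ((3 * a + 3 * b - 2 : ℤ) : ℂ) = ∑ x : F, (t (x * (1 - x)) : ℂ) := by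
        have h1 : ((3 * a + 3 * b - 2 : ℤ) : ℂ) = jacobiSum χ χ + jacobiSum χ⁻¹ χ⁻¹ := by
          linear_combination (-1 / 2 : ℂ) * hJ2 - (1 / 2 : ℂ) * hJ2'
        rw [h1, jacobiSum, jacobiSum, ← Finset.sum_add_distrib]
        refine Finset.sum_congr rfl fun x _ => ?_
        rw [← ht, ← map_mul, ← map_mul, hinv, MulChar.pow_apply' _ two_ne_zero]
      exact_mod_cast h
    have hzero : ((∑ x : F, t (x * (1 - x)) : ℤ) : F) = 0 := by
      rw [← hsum, CharP.intCast_eq_zero_iff F p]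
      exact hdvd
    rw [Int.cast_sum] at hzero
    simp only [← ht', Finset.sum_add_distrib] at hzero
    rw [sum_mul_one_sub_pow_third hn0 (hF.trans hn),
      sum_mul_one_sub_pow_two_thirds hn0 (hF.trans hn), zero_add, mul_eq_zero] at hzero
    rcases hzero with h | h
    · exact pow_ne_zero _ (neg_ne_zero.2 one_ne_zero) h
    · exact not_dvd_choose_of_three_mul_add_one_eq_pow hp1 k hn.symm
        ((CharP.cast_eq_zero_iff F p _).1 h)

lemma isPrimitive_of_eq_exp_trace {p : ℕ} [Fact p.Prime] {F : Type*} [Field F] [Finite F]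
    [Algebra (ZMod p) F] {ψ : AddChar F ℂ}
    (hψ : ∀ x : F, ψ x = Complex.exp (2 * (Real.pi : ℂ) * Complex.I
      * ((Algebra.trace (ZMod p) F x).val : ℂ) / (p : ℂ))) : ψ.IsPrimitive := by
  have hp : p.Prime := Fact.out
  refine AddChar.IsPrimitive.of_ne_one ?_
  rintro rfl
  have : Module.Finite (ZMod p) F := Module.Finite.of_finite
  obtain ⟨x, hx⟩ := Algebra.trace_surjective (ZMod p) F 1
  have h := hψ x
  have : Fact (1 < p) := ⟨hp.one_lt⟩
  rw [AddChar.one_apply, hx, ZMod.val_one, Nat.cast_one, mul_one] at h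
  exact (Complex.isPrimitiveRoot_exp p hp.ne_zero).ne_one hp.one_lt h.symm

/-- `Re(G(χ,ψ)³) = cq/2`, `|Im(G(χ,ψ)³)| = (3√3/2)·q·d`; in other words,
`G(χ,ψ)³ = cq/2 + θ(q)·(3√3·q·d/2)·i`, where `θ(q)` is the sign of the
imaginary part of `G(χ,ψ)³`. -/
theorem gaussSum_cube_eq
    (p k q : ℕ) [Fact p.Prime] (hk : 0 < k) (hq : q = p ^ k) (hq3 : q % 3 = 1)
    (F : Type) [Field F] [Fintype F] [Algebra (ZMod p) F] (hF : Fintype.card F = q)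
    (g : Fˣ) (hg : ∀ x : Fˣ, x ∈ Subgroup.zpowers g)
    (χ : MulChar F ℂ) (hχ : χ (g : F) = (-1 + (Real.sqrt 3 : ℂ) * Complex.I) / 2)
    (ψ : AddChar F ℂ)
    (hψ : ∀ x : F, ψ x = Complex.exp (2 * (Real.pi : ℂ) * Complex.I
      * ((Algebra.trace (ZMod p) F x).val : ℂ) / (p : ℂ)))
    (c d : ℤ) (h4q : 4 * (q : ℤ) = c ^ 2 + 27 * d ^ 2) (hc3 : c % 3 = 1)
    (hd : 0 ≤ d) (hcp : p % 3 = 1 → IsCoprime c (p : ℤ)) :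
    (gaussSum χ ψ ^ 3).re = (c : ℝ) * (q : ℝ) / 2
    ∧ |(gaussSum χ ψ ^ 3).im| = 3 * Real.sqrt 3 / 2 * (q : ℝ) * (d : ℝ)
    ∧ gaussSum χ ψ ^ 3
        = (c : ℂ) * (q : ℂ) / 2
          + ((Real.sign ((gaussSum χ ψ ^ 3).im) : ℝ) : ℂ)
            * (3 * (Real.sqrt 3 : ℂ) * (q : ℂ) * (d : ℂ) / 2) * Complex.I := by
  subst hq
  have hpp : p.Prime := Fact.out
  have : CharP F p := charP_of_injective_algebraMap (algebraMap (ZMod p) F).injective p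
  have hω : 1 + χ g + χ g ^ 2 = 0 := by
    rw [hχ]
    exact one_add_add_sq_neg_one_add_sqrt_three_mul_I_div_two
  have hχ3 : χ ^ 3 = 1 := by
    refine MulChar.eq_one_iff.2 fun x => ?_
    obtain ⟨j, rfl⟩ := (Submonoid.mem_powers_iff _ _).1 (mem_powers_iff_mem_zpowers.2 (hg x))
    rw [MulChar.pow_apply_coe, Units.val_pow_eq_pow_val, map_pow, ← pow_mul, mul_comm, pow_mul,
      show χ g ^ 3 = 1 by linear_combination (χ g - 1) * hω, one_pow]
  have hχ1 : χ ≠ 1 := by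
    rintro rfl
    norm_num [MulChar.one_apply_coe] at hω
  have hord : orderOf χ = 3 := by
    have : Fact (Nat.Prime 3) := ⟨Nat.prime_three⟩
    exact orderOf_eq_prime hχ3 hχ1
  have hneg : χ (-1) = 1 := by
    have h : χ ((-1) ^ 3) = 1 := by
      rw [map_pow, ← MulChar.pow_apply' _ three_ne_zero, hχ3,
        MulChar.one_apply isUnit_one.neg]
    simpa [Odd.neg_one_pow (by decide : Odd 3)] using h
  have hG : gaussSum χ ψ ^ 3 = (p : ℂ) ^ k * jacobiSum χ χ := by
    have h := gaussSum_pow_eq_prod_jacobiSum (χ := χ) (ψ := ψ) (by omega)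
      (isPrimitive_of_eq_exp_trace hψ)
    simpa [hord, hneg, hF] using h
  obtain ⟨c', d', hc3', h4q', hcp', hJ⟩ := exists_two_mul_jacobiSum_eq hF hq3 hk hχ3 hχ1
  push_cast at h4q
  have hdd : d ^ 2 = d' ^ 2 := by
    have h3 : p % 3 = 1 ∨ p % 3 = 2 := by
      have h0 : p % 3 ≠ 0 := by
        intro h0
        rw [Nat.pow_mod, h0, zero_pow hk.ne'] at hq3
        omega
      omega
    rcases h3 with h3 | h3
    · refine sq_eq_sq_of_four_mul_pow_eq h3 h4q h4q' (fun h => ?_) (hcp' h3) hk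
      exact (Nat.prime_iff_prime_int.1 hpp).not_isUnit ((hcp h3).isUnit_of_dvd' h dvd_rfl)
    · rw [eq_zero_of_four_mul_pow_eq h3 hq3 h4q, eq_zero_of_four_mul_pow_eq h3 hq3 h4q']
  have hc : c' = c := by
    have h : c' ^ 2 = c ^ 2 := by linarith
    rcases sq_eq_sq_iff_eq_or_eq_neg.1 h with h | h <;> omega
  subst hc
  have hd' : |(d' : ℝ)| = d := by
    rw [← Int.cast_abs, ← (sq_eq_sq_iff_abs_eq_abs _ _).1 hdd, abs_of_nonneg hd]
  have hz : gaussSum χ ψ ^ 3 = ((c' * (p : ℝ) ^ k / 2 : ℝ) : ℂ)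
      + ((3 * Real.sqrt 3 / 2 * (p : ℝ) ^ k * d' : ℝ) : ℂ) * Complex.I := by
    rw [hG]
    push_cast
    linear_combination ((p : ℂ) ^ k / 2) * hJ
  have hre : (gaussSum χ ψ ^ 3).re = c' * (p : ℝ) ^ k / 2 := by
    rw [hz, Complex.add_re, Complex.ofReal_re, Complex.re_ofReal_mul, Complex.I_re, mul_zero,
      add_zero]
  have him : (gaussSum χ ψ ^ 3).im = 3 * Real.sqrt 3 / 2 * (p : ℝ) ^ k * d' := by
    rw [hz, Complex.add_im, Complex.ofReal_im, Complex.im_ofReal_mul, Complex.I_im, mul_one,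
      zero_add]
  have habs : |(gaussSum χ ψ ^ 3).im| = 3 * Real.sqrt 3 / 2 * (p : ℝ) ^ k * d := by
    rw [him, abs_mul, hd', abs_of_nonneg (by positivity)]
  have hsign : (gaussSum χ ψ ^ 3).im
      = Real.sign (gaussSum χ ψ ^ 3).im * (3 * Real.sqrt 3 * (p : ℝ) ^ k * d / 2) := by
    rw [show 3 * Real.sqrt 3 * (p : ℝ) ^ k * d / 2 = |(gaussSum χ ψ ^ 3).im| by
      rw [habs]
      ring]
    rcases lt_trichotomy (gaussSum χ ψ ^ 3).im 0 with h | h | h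
    · rw [Real.sign_of_neg h, abs_of_neg h, neg_one_mul, neg_neg]
    · rw [h, abs_zero, mul_zero]
    · rw [Real.sign_of_pos h, abs_of_pos h, one_mul]
  push_cast
  refine ⟨hre, habs, ?_⟩
  have hsign' := congrArg (fun x : ℝ => (x : ℂ)) hsign
  have hre' := congrArg (fun x : ℝ => (x : ℂ)) hre
  push_cast at hsign' hre'
  rw [← hre', ← hsign', Complex.re_add_im]
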